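/- arXiv:2211.09571 — 2 statements merged into one kernel-verified Lean document; each statement's English description precedes it below -/
import Mathlib

section
/- There exists a hedonic diversity game with 10 agents (4 red and 6 blue) in which all agents have strict preferences, and an initial partition, such that no partition reachable from the initial partition by a finite sequence of IS deviations is individually stable; hence the dynamics of IS deviations can never reach an individually stable partition, whatever the chosen path of deviations. -/
/-- A partition of the agent set `A`, encoded by the map sending each agent to
the coalition containing it. -/
def IsPartition {A : Type*} [DecidableEq A] (π : A → Finset A) : Prop :=
  (∀ i, i ∈ π i) ∧ ∀ i j, i ∈ π j → π i = π j

/-- Strict part of a weak preference relation `r`. -/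
def StrictPref {α : Type*} (r : α → α → Prop) (x y : α) : Prop :=
  r x y ∧ ¬ r y x

/-- `π'` is obtained from `π` by an IS deviation of agent `i`, where
`wp j C D` means that agent `j` weakly prefers coalition `C` to coalition `D`. -/
def IsISDeviation {A : Type*} [DecidableEq A]
    (wp : A → Finset A → Finset A → Prop) (π π' : A → Finset A) (i : A) : Prop :=
  π' i ≠ π i ∧
  (∀ j, j ≠ i → (π' j).erase i = (π j).erase i) ∧
  StrictPref (wp i) (π' i) (π i) ∧
  ∀ j ∈ (π' i).erase i, wp j (π' j) (π j)

/-- One step of the dynamics of IS deviations between partitions. -/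
def ISStep {A : Type*} [DecidableEq A]
    (wp : A → Finset A → Finset A → Prop) (π π' : A → Finset A) : Prop :=
  IsPartition π ∧ IsPartition π' ∧ ∃ i, IsISDeviation wp π π' i

/-- A partition is individually stable if no IS deviation from it is possible. -/
def IndividuallyStable {A : Type*} [DecidableEq A]
    (wp : A → Finset A → Finset A → Prop) (π : A → Finset A) : Prop :=
  IsPartition π ∧ ∀ π' : A → Finset A, ¬ ISStep wp π π'

/-- `r` is a weak order (total preorder) on the set `S`. -/
def WeakOrderOn {α : Type*} (r : α → α → Prop) (S : Set α) : Prop :=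
  (∀ x ∈ S, ∀ y ∈ S, r x y ∨ r y x) ∧
  ∀ x ∈ S, ∀ y ∈ S, ∀ z ∈ S, r x y → r y z → r x z

/-- `r` is antisymmetric on `S`, i.e. the preferences are strict. -/
def StrictPrefsOn {α : Type*} (r : α → α → Prop) (S : Set α) : Prop :=
  ∀ x ∈ S, ∀ y ∈ S, r x y → r y x → x = y

/-- `r` is (naturally) single-peaked on `S` with respect to the natural linear
order of `α`: whenever `y` lies strictly between `x` and `z`, `x ≻ y` implies `y ≿ z`. -/
def SinglePeakedOn {α : Type*} [LinearOrder α] (r : α → α → Prop) (S : Set α) : Prop :=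
  ∀ x ∈ S, ∀ y ∈ S, ∀ z ∈ S,
    ((x < y ∧ y < z) ∨ (z < y ∧ y < x)) → StrictPref r x y → r y z

/-- The fraction of red agents (members of `R`) in the coalition `C`. -/
def redRatio {A : Type*} [DecidableEq A] (R : Finset A) (C : Finset A) : ℚ :=
  ((R ∩ C).card : ℚ) / (C.card : ℚ)

/-- The set of ratios `p/q` with `0 ≤ p ≤ r` and `1 ≤ q ≤ n`. -/
def RatioSet (r n : ℕ) : Set ℚ :=
  {x : ℚ | ∃ p q : ℕ, p ≤ r ∧ 1 ≤ q ∧ q ≤ n ∧ x = (p : ℚ) / (q : ℚ)}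

/-- Coalition preferences of a hedonic diversity game with red agents `R`:
coalitions are compared by their fraction of red agents via the ratio
preferences `rp`. -/
def hdgPref {A : Type*} [DecidableEq A] (R : Finset A) (rp : A → ℚ → ℚ → Prop) :
    A → Finset A → Finset A → Prop :=
  fun i C D => rp i (redRatio R C) (redRatio R D)

/-- A coalition is homogeneous if it consists only of red agents or only of
blue agents. -/
def HomogeneousCoalition {A : Type*} [DecidableEq A] (R : Finset A) (C : Finset A) : Prop :=
  C ⊆ R ∨ ∀ a ∈ C, a ∉ R

/-- One step of the dynamics of IS deviations in a hedonic diversity game in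
which the deviation satisfies solitary homogeneity: if the target coalition of
the deviator is homogeneous, then it is a singleton. -/
def ISStepSH {A : Type*} [DecidableEq A] (R : Finset A) (rp : A → ℚ → ℚ → Prop)
    (π π' : A → Finset A) : Prop :=
  IsPartition π ∧ IsPartition π' ∧
  ∃ i, IsISDeviation (hdgPref R rp) π π' i ∧
    (HomogeneousCoalition R (π' i) → (π' i).card = 1)

/-- The preference lists: for each agent, ratios from best to worst. -/
def prefList : Fin 10 → List ℚ :=
  ![[0, 1/7, 4/9, 4/7, 2/3, 3/8, 3/5, 2/7, 3/7, 1/3, 2/5, 1/2, 3/4, 1/4, 1/6, 4/5, 1, 1/5],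
    [0, 1/7, 3/4, 2/7, 1/6, 3/7, 1/3, 2/5, 1/4, 4/9, 3/8, 4/7, 2/3, 1/5, 3/5, 1, 1/2, 4/5],
    [0, 1/7, 1/6, 4/7, 2/3, 3/5, 1/5, 4/9, 1/2, 2/5, 3/4, 1/4, 3/7, 1/3, 3/8, 4/5, 1, 2/7],
    [0, 3/8, 3/4, 2/7, 4/7, 2/3, 3/5, 1/4, 3/7, 1/2, 2/5, 4/5, 1/3, 1/5, 1/6, 1/7, 4/9, 1],
    [3/5, 1/6, 2/7, 1/5, 1/2, 1/3, 2/5, 1/4, 3/8, 3/7, 4/9, 4/7, 4/5, 0, 1/7, 3/4, 2/3, 1],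
    [1/7, 2/5, 1/5, 1/4, 4/9, 3/8, 2/7, 4/7, 3/4, 2/3, 3/5, 1/3, 1/6, 3/7, 1/2, 0, 4/5, 1],
    [1/7, 3/7, 1/3, 4/9, 3/8, 2/7, 1/6, 1/5, 2/5, 1/4, 4/5, 0, 4/7, 3/4, 2/3, 1/2, 3/5, 1],
    [1/7, 3/7, 1/3, 4/9, 3/8, 2/7, 1/6, 1/5, 2/5, 1/4, 4/5, 0, 4/7, 3/4, 2/3, 1/2, 3/5, 1],
    [1/7, 2/5, 1/5, 1/4, 4/7, 3/4, 2/3, 3/5, 1/3, 4/9, 3/8, 1/6, 1/2, 2/7, 3/7, 0, 4/5, 1],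
    [1/7, 3/7, 1/3, 4/9, 3/8, 2/7, 1/6, 1/5, 2/5, 1/4, 4/5, 3/4, 0, 4/7, 2/3, 1/2, 3/5, 1]]

/-- Weak preference on ratios: position in the list, ties between unlisted ratios broken by `≤`. -/
def ratioPref (i : Fin 10) (x y : ℚ) : Prop :=
  (prefList i).idxOf x < (prefList i).idxOf y ∨
    ((prefList i).idxOf x = (prefList i).idxOf y ∧ x ≤ y)

instance ratioPrefDec (i : Fin 10) (x y : ℚ) : Decidable (ratioPref i x y) :=
  inferInstanceAs (Decidable (_ ∨ _))

/-- Red agents. -/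
def reds : Finset (Fin 10) := {0, 1, 2, 3}

/-- First coalition in the six states of the cycle. -/
def firstCoal : Fin 6 → Finset (Fin 10) :=
  ![{0, 1, 6, 7, 9},
    {0, 1, 4, 6, 7, 9},
    {1, 4, 6, 7, 9},
    {4, 6, 7, 9},
    {6, 7, 9},
    {1, 6, 7, 9}]

/-- The six partitions of the cycle. -/
def cyc (s : Fin 6) (i : Fin 10) : Finset (Fin 10) :=
  if i ∈ firstCoal s then firstCoal s else (firstCoal s)ᶜ

/-- The partition after agent `i` joins the set `T`. -/
def moveTo (π : Fin 10 → Finset (Fin 10)) (i : Fin 10) (T : Finset (Fin 10)) (k : Fin 10) :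
    Finset (Fin 10) :=
  if k = i ∨ k ∈ T then insert i T else (π k).erase i

/-- Target of a deviation of `i` to the coalition of `j` (to the singleton if `j = i`). -/
def target (π : Fin 10 → Finset (Fin 10)) (i j : Fin 10) : Finset (Fin 10) :=
  if j = i then ∅ else (π j).erase i

instance hdgPrefDec (i : Fin 10) (C D : Finset (Fin 10)) :
    Decidable (hdgPref reds ratioPref i C D) :=
  ratioPrefDec i (redRatio reds C) (redRatio reds D)

instance strictDec (i : Fin 10) (C D : Finset (Fin 10)) :
    Decidable (StrictPref (hdgPref reds ratioPref i) C D) :=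
  inferInstanceAs (Decidable (_ ∧ _))

instance devDec (π π' : Fin 10 → Finset (Fin 10)) (i : Fin 10) :
    Decidable (IsISDeviation (hdgPref reds ratioPref) π π' i) :=
  inferInstanceAs (Decidable (_ ∧ _ ∧ _ ∧ _))

instance partDec (π : Fin 10 → Finset (Fin 10)) : Decidable (IsPartition π) :=
  inferInstanceAs (Decidable (_ ∧ _))

theorem cyc_partition : ∀ s, IsPartition (cyc s) := by decide +kernel

theorem cyc_dev : ∀ s, ∃ i, IsISDeviation (hdgPref reds ratioPref) (cyc s) (cyc (s + 1)) i := by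
  decide +kernel

theorem cyc_unique : ∀ s i j,
    IsISDeviation (hdgPref reds ratioPref) (cyc s) (moveTo (cyc s) i (target (cyc s) i j)) i →
    moveTo (cyc s) i (target (cyc s) i j) = cyc (s + 1) := by
  decide +kernel

theorem eq_moveTo {π π' : Fin 10 → Finset (Fin 10)} {i : Fin 10} (h' : IsPartition π')
    (he : ∀ j, j ≠ i → (π' j).erase i = (π j).erase i) :
    ∃ j, π' = moveTo π i (target π i j) := by
  have hT : ∃ j, (π' i).erase i = target π i j := by
    rcases ((π' i).erase i).eq_empty_or_nonempty with h | ⟨j, hj⟩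
    · exact ⟨i, by simp [target, h]⟩
    · have hj' := Finset.mem_erase.1 hj
      refine ⟨j, ?_⟩
      rw [target, if_neg hj'.1, ← he j hj'.1, h'.2 j i hj'.2]
  obtain ⟨j, hj⟩ := hT
  refine ⟨j, ?_⟩
  rw [← hj]
  funext k
  unfold moveTo
  rw [Finset.insert_erase (h'.1 i)]
  split_ifs with hk
  · rcases hk with rfl | hk
    · rfl
    · exact h'.2 k i (Finset.mem_erase.1 hk).2
  · push Not at hk
    rw [← he k hk.1, Finset.erase_eq_of_notMem]
    intro hi
    apply hk.2
    rw [Finset.mem_erase, h'.2 i k hi]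
    exact ⟨hk.1, h'.1 k⟩

theorem cyc_step {s : Fin 6} {π' : Fin 10 → Finset (Fin 10)}
    (h : ISStep (hdgPref reds ratioPref) (cyc s) π') : π' = cyc (s + 1) := by
  obtain ⟨-, h', i, hd⟩ := h
  obtain ⟨j, rfl⟩ := eq_moveTo h' hd.2.1
  exact cyc_unique s i j hd

/-- There exists a hedonic diversity game with 10 agents (4 red, 6 blue) with
strict preferences, and an initial partition, such that no partition reachable
from it by IS deviations is individually stable. -/
theorem hdg_strict_never_reach_IS :
    ∃ (R : Finset (Fin 10)) (rp : Fin 10 → ℚ → ℚ → Prop),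
      R.card = 4 ∧
      (∀ i, WeakOrderOn (rp i) (RatioSet R.card 10)) ∧
      (∀ i, StrictPrefsOn (rp i) (RatioSet R.card 10)) ∧
      ∃ π0 : Fin 10 → Finset (Fin 10),
        IsPartition π0 ∧
        ∀ (m : ℕ) (seq : ℕ → Fin 10 → Finset (Fin 10)),
          seq 0 = π0 →
          (∀ k < m, ISStep (hdgPref R rp) (seq k) (seq (k + 1))) →
          ¬ IndividuallyStable (hdgPref R rp) (seq m) := by
  refine ⟨reds, ratioPref, by decide, ?_, ?_, cyc 0, cyc_partition 0, ?_⟩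
  · intro i
    refine ⟨fun x _ y _ => ?_, fun x _ y _ z _ h1 h2 => ?_⟩
    · unfold ratioPref
      rcases lt_trichotomy ((prefList i).idxOf x) ((prefList i).idxOf y) with h | h | h
      · exact Or.inl (Or.inl h)
      · rcases le_total x y with h2 | h2
        · exact Or.inl (Or.inr ⟨h, h2⟩)
        · exact Or.inr (Or.inr ⟨h.symm, h2⟩)
      · exact Or.inr (Or.inl h)
    · unfold ratioPref at *
      rcases h1 with h1 | ⟨h1, h1'⟩ <;> rcases h2 with h2 | ⟨h2, h2'⟩
      · exact Or.inl (h1.trans h2)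
      · exact Or.inl (h2 ▸ h1)
      · exact Or.inl (h1 ▸ h2)
      · exact Or.inr ⟨h1.trans h2, h1'.trans h2'⟩
  · intro i x _ y _ h1 h2
    unfold ratioPref at *
    rcases h1 with h1 | ⟨h1, h1'⟩ <;> rcases h2 with h2 | ⟨h2, h2'⟩
    · omega
    · omega
    · omega
    · exact le_antisymm h1' h2'
  · intro m seq h0 hs
    have key : ∀ k ≤ m, ∃ s, seq k = cyc s := by
      intro k
      induction k with
      | zero => exact fun _ => ⟨0, h0⟩
      | succ k ih =>
        intro hk
        obtain ⟨s, e⟩ := ih (by omega)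
        have h := hs k (by omega)
        rw [e] at h
        exact ⟨s + 1, cyc_step h⟩
    obtain ⟨s, e⟩ := key m le_rfl
    intro hst
    rw [e] at hst
    exact hst.2 (cyc (s + 1)) ⟨cyc_partition s, cyc_partition (s + 1), cyc_dev s⟩
end

section
/- There exists a symmetric fractional hedonic game on 15 agents (with integer-valued, symmetric utility functions v_i with v_i(i) = 0 and v_i(j) = v_j(i)) that admits no individually stable partition. -/
/-- The utility of agent `i` for the coalition `C` in a fractional hedonic game
with utility functions `v`: the average value of the members of `C`. -/
def fhgUtil {A : Type*} [DecidableEq A] (v : A → A → ℚ) (i : A) (C : Finset A) : ℚ :=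
  (∑ j ∈ C, v i j) / (C.card : ℚ)

/-- Coalition preferences of a fractional hedonic game. -/
def fhgPref {A : Type*} [DecidableEq A] (v : A → A → ℚ) :
    A → Finset A → Finset A → Prop :=
  fun i C D => fhgUtil v i D ≤ fhgUtil v i C

/-- Table of the utilities of the game. -/
def tab : List (List ℤ) :=
  [[0, 220, 334, 353, -10000, 263, -10000, -10000, -10000, -10000, -10000, -10000, 353, -10000, 348],
   [220, 0, -10000, -10000, 120, -10000, -10000, -10000, -10000, -10000, -10000, -10000, -10000, 120, -10000],
   [334, -10000, 0, 348, -10000, 449, -10000, -10000, -10000, -10000, -10000, -10000, 263, -10000, 449],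
   [353, -10000, 348, 0, 220, 334, 353, -10000, 263, -10000, -10000, -10000, -10000, -10000, -10000],
   [-10000, 120, -10000, 220, 0, -10000, -10000, 120, -10000, -10000, -10000, -10000, -10000, -10000, -10000],
   [263, -10000, 449, 334, -10000, 0, 348, -10000, 449, -10000, -10000, -10000, -10000, -10000, -10000],
   [-10000, -10000, -10000, 353, -10000, 348, 0, 220, 334, 353, -10000, 263, -10000, -10000, -10000],
   [-10000, -10000, -10000, -10000, 120, -10000, 220, 0, -10000, -10000, 120, -10000, -10000, -10000, -10000],
   [-10000, -10000, -10000, 263, -10000, 449, 334, -10000, 0, 348, -10000, 449, -10000, -10000, -10000],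
   [-10000, -10000, -10000, -10000, -10000, -10000, 353, -10000, 348, 0, 220, 334, 353, -10000, 263],
   [-10000, -10000, -10000, -10000, -10000, -10000, -10000, 120, -10000, 220, 0, -10000, -10000, 120, -10000],
   [-10000, -10000, -10000, -10000, -10000, -10000, 263, -10000, 449, 334, -10000, 0, 348, -10000, 449],
   [353, -10000, 263, -10000, -10000, -10000, -10000, -10000, -10000, 353, -10000, 348, 0, 220, 334],
   [-10000, 120, -10000, -10000, -10000, -10000, -10000, -10000, -10000, -10000, 120, -10000, 220, 0, -10000],
   [348, -10000, 449, -10000, -10000, -10000, -10000, -10000, -10000, 263, -10000, 449, 334, -10000, 0]]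

/-- Utility functions. -/
def vv (i j : Fin 15) : ℤ := (tab.getD i.val []).getD j.val 0

/-- Cliques of mutually acceptable agents. -/
def cliques : List (Fin 15) → List (List (Fin 15))
  | [] => [[]]
  | x :: xs => cliques xs ++
      ((cliques xs).filter fun c => c.all fun y => decide (0 ≤ vv x y)).map (x :: ·)

/-- Total value of a list of agents. -/
def uu (i : Fin 15) (c : List (Fin 15)) : ℤ := (c.map (vv i)).sum

/-- Some agent of `c` has an IS deviation to `d`. -/
def blocks (c d : List (Fin 15)) : Bool :=
  c.any fun i =>
    decide (uu i c * (d.length + 1 : ℕ) < uu i d * (c.length : ℕ)) &&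
    d.all fun j => decide (uu j d * (d.length + 1 : ℕ) ≤ (uu j d + vv j i) * (d.length : ℕ))

/-- The coalitions `c` and `d` may occur in the same stable partition. -/
def compat (c d : List (Fin 15)) : Bool :=
  decide (c = d) || ((c.all fun x => !(decide (x ∈ d))) && (!(blocks c d) && !(blocks d c)))

/-- Exhaustive search: no stable partition can be composed from `al`. -/
def search : List (Fin 15) → List (List (Fin 15)) → Bool
  | [], _ => false
  | i :: is, al => al.all fun c =>
      !(decide (i ∈ c)) || search is (al.filter (compat c))

theorem search_all :
    search [0, 2, 3, 5, 6, 8, 9, 11, 12, 14, 1, 4, 7, 10, 13] (cliques (List.finRange 15)) = true := by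
  decide +kernel

theorem vv_self : ∀ i, vv i i = 0 := by decide +kernel
theorem vv_symm : ∀ i j, vv i j = vv j i := by decide +kernel
theorem vv_le : ∀ i j, vv i j ≤ 500 := by decide +kernel
theorem vv_neg : ∀ i j, vv i j < 0 → vv i j ≤ -10000 := by decide +kernel

theorem mem_cliques (p : Fin 15 → Bool) (hp : ∀ x y, p x → p y → 0 ≤ vv x y)
    (l : List (Fin 15)) : l.filter p ∈ cliques l := by
  induction l with
  | nil => simp [cliques]
  | cons x xs ih =>
    rw [cliques, List.mem_append]
    by_cases hx : p x = true
    · right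
      rw [List.filter_cons_of_pos hx]
      refine List.mem_map.2 ⟨_, List.mem_filter.2 ⟨ih, ?_⟩, rfl⟩
      rw [List.all_eq_true]
      intro y hy
      simpa using hp x y hx (List.mem_filter.1 hy).2
    · left
      rw [List.filter_cons_of_neg hx]
      exact ih

/-- The list of members of a coalition. -/
def toL (C : Finset (Fin 15)) : List (Fin 15) := (List.finRange 15).filter fun x => decide (x ∈ C)

theorem mem_toL (C : Finset (Fin 15)) (x : Fin 15) : x ∈ toL C ↔ x ∈ C := by
  simp [toL]

theorem nodup_toL (C : Finset (Fin 15)) : (toL C).Nodup := (List.nodup_finRange 15).filter _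

theorem toL_toFinset (C : Finset (Fin 15)) : (toL C).toFinset = C := by
  ext x; simp [mem_toL]

theorem length_toL (C : Finset (Fin 15)) : (toL C).length = C.card := by
  conv_rhs => rw [← toL_toFinset C]
  rw [List.toFinset_card_of_nodup (nodup_toL C)]

theorem uu_toL (i : Fin 15) (C : Finset (Fin 15)) : uu i (toL C) = ∑ j ∈ C, vv i j := by
  conv_rhs => rw [← toL_toFinset C]
  rw [List.sum_toFinset _ (nodup_toL C)]
  rfl

theorem search_sound (π : Fin 15 → Finset (Fin 15)) (hπ : ∀ i, i ∈ π i)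
    (hc : ∀ i j, compat (toL (π i)) (toL (π j)) = true) :
    ∀ (is : List (Fin 15)) (al : List (List (Fin 15))), (∀ j, toL (π j) ∈ al) →
      search is al = true → False := by
  intro is
  induction is with
  | nil => intro al _ h; simp [search] at h
  | cons i is ih =>
    intro al hal h
    rw [search, List.all_eq_true] at h
    have h1 := h _ (hal i)
    have hi : i ∈ toL (π i) := (mem_toL _ _).2 (hπ i)
    simp only [hi, decide_true, Bool.not_true, Bool.false_or] at h1
    exact ih _ (fun j => List.mem_filter.2 ⟨hal j, hc i j⟩) h1

theorem no_dev {A : Type*} [DecidableEq A] (V : A → A → ℚ) (π : A → Finset A)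
    (h : IndividuallyStable (fhgPref V) π) (i : A) (D : Finset A) (hi : i ∉ D)
    (hD : ∀ j ∈ D, π j = D)
    (hacc : ∀ j ∈ D, fhgUtil V j D ≤ fhgUtil V j (insert i D)) :
    fhgUtil V i (insert i D) ≤ fhgUtil V i (π i) := by
  by_contra hlt
  obtain ⟨⟨hm, he⟩, hs⟩ := h
  let π' : A → Finset A := fun j => if j = i ∨ j ∈ D then insert i D else (π j).erase i
  have hpi : π' i = insert i D := by simp [π']
  have hpD : ∀ j ∈ D, π' j = insert i D := fun j hj => by simp [π', hj]
  refine hs π' ⟨⟨hm, he⟩, ⟨?_, ?_⟩, i, ?_, ?_, ?_, ?_⟩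
  · intro j
    by_cases hj : j = i ∨ j ∈ D
    · simp only [π', if_pos hj]; exact Finset.mem_insert.2 hj
    · simp only [π', if_neg hj]
      exact Finset.mem_erase.2 ⟨fun e => hj (Or.inl e), hm j⟩
  · intro a b hab
    by_cases hb : b = i ∨ b ∈ D
    · simp only [π', if_pos hb] at hab ⊢
      rw [if_pos (Finset.mem_insert.1 hab)]
    · simp only [π', if_neg hb] at hab ⊢
      obtain ⟨h1, h2⟩ := Finset.mem_erase.1 hab
      have h3 := he a b h2
      have ha : ¬ (a = i ∨ a ∈ D) := by
        rintro (e | e)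
        · exact h1 e
        · apply hb; right
          rw [← hD a e, h3]; exact hm b
      rw [if_neg ha, h3]
  · rw [hpi]; intro e; rw [e] at hlt; exact hlt le_rfl
  · intro j hj
    by_cases hjD : j ∈ D
    · rw [hpD j hjD, hD j hjD]
      simp
    · simp [π', hj, hjD]
  · rw [hpi]
    exact ⟨(not_le.1 hlt).le, hlt⟩
  · intro j hj
    rw [hpi, Finset.erase_insert hi] at hj
    rw [hpD j hj, hD j hj]
    exact hacc j hj

theorem util_eq (i : Fin 15) (C : Finset (Fin 15)) :
    fhgUtil (fun i j => (vv i j : ℚ)) i C = (uu i (toL C) : ℚ) / ((toL C).length : ℚ) := by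
  rw [fhgUtil, uu_toL, length_toL]; push_cast; rfl

theorem util_insert (i j : Fin 15) (C : Finset (Fin 15)) (hj : j ∉ C) :
    fhgUtil (fun i j => (vv i j : ℚ)) i (insert j C) =
      ((uu i (toL C) + vv i j : ℤ) : ℚ) / (((toL C).length + 1 : ℕ) : ℚ) := by
  rw [fhgUtil, uu_toL, length_toL, Finset.sum_insert hj, Finset.card_insert_of_notMem hj]
  push_cast; rw [add_comm]

theorem not_blocks (π : Fin 15 → Finset (Fin 15))
    (h : IndividuallyStable (fhgPref fun i j => (vv i j : ℚ)) π) (a b : Fin 15)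
    (hd : ∀ x ∈ π a, x ∉ π b) : blocks (toL (π a)) (toL (π b)) = false := by
  rw [Bool.eq_false_iff]
  intro hb
  rw [blocks, List.any_eq_true] at hb
  obtain ⟨i, hi, hb⟩ := hb
  rw [Bool.and_eq_true, List.all_eq_true] at hb
  obtain ⟨h1, h2⟩ := hb
  have h1 := of_decide_eq_true h1
  rw [mem_toL] at hi
  have hib := hd i hi
  have hpos : ∀ c, 0 < (toL (π c)).length := fun c =>
    List.length_pos_of_mem ((mem_toL _ _).2 (h.1.1 c))
  have key := no_dev _ π h i (π b) hib (fun j hj => h.1.2 j b hj) ?_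
  · rw [h.1.2 i a hi, util_insert _ _ _ hib, util_eq, div_le_div_iff₀ (by positivity)
      (by exact_mod_cast hpos a), vv_self, add_zero] at key
    have key' : uu i (toL (π b)) * ((toL (π a)).length : ℕ) ≤
      uu i (toL (π a)) * ((toL (π b)).length + 1 : ℕ) := by exact_mod_cast key
    exact absurd h1 (not_lt.2 key')
  · intro j hj
    have h3 := of_decide_eq_true (h2 j ((mem_toL _ _).2 hj))
    rw [util_insert _ _ _ hib, util_eq, div_le_div_iff₀ (by exact_mod_cast hpos b) (by positivity)]
    exact_mod_cast h3

theorem rational (π : Fin 15 → Finset (Fin 15))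
    (h : IndividuallyStable (fhgPref fun i j => (vv i j : ℚ)) π) (i j : Fin 15)
    (hj : j ∈ π i) : 0 ≤ vv i j := by
  by_contra hneg
  have h1 := vv_neg i j (not_le.1 hneg)
  have key := no_dev _ π h i ∅ (by simp) (by simp) (by simp)
  have hc : 0 < ((π i).card : ℚ) := by exact_mod_cast Finset.card_pos.2 ⟨i, h.1.1 i⟩
  have h0 : fhgUtil (fun i j => (vv i j : ℚ)) i (insert i ∅) = 0 := by
    simp [fhgUtil, vv_self]
  rw [h0, fhgUtil, le_div_iff₀ hc, zero_mul] at key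
  have key' : 0 ≤ ∑ k ∈ π i, vv i k := by exact_mod_cast key
  rw [← Finset.add_sum_erase _ _ hj] at key'
  have h2 : ∑ k ∈ (π i).erase j, vv i k ≤ ((π i).erase j).card • (500 : ℤ) :=
    Finset.sum_le_card_nsmul _ _ _ fun k _ => vv_le i k
  have h3 : ((π i).erase j).card ≤ 15 := by
    simpa using Finset.card_le_univ ((π i).erase j)
  rw [nsmul_eq_mul] at h2
  have h4 : (((π i).erase j).card : ℤ) ≤ 15 := by exact_mod_cast h3
  linarith

theorem no_stable (π : Fin 15 → Finset (Fin 15))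
    (h : IndividuallyStable (fhgPref fun i j => (vv i j : ℚ)) π) : False := by
  refine search_sound π h.1.1 ?_ _ _ ?_ search_all
  · intro a b
    rw [compat, Bool.or_eq_true]
    by_cases hab : π a = π b
    · left; rw [hab]; exact decide_eq_true rfl
    · right
      have hd : ∀ x ∈ π a, x ∉ π b := fun x hx hy => hab ((h.1.2 x a hx).symm.trans (h.1.2 x b hy))
      rw [not_blocks π h a b hd, not_blocks π h b a fun x hx hy => hd x hy hx]
      simpa [mem_toL] using hd
  · intro j
    apply mem_cliques
    intro x y hx hy
    have hx := of_decide_eq_true hx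
    have hy := of_decide_eq_true hy
    refine rational π h x y ?_
    rw [h.1.2 x j hx]; exact hy

/-- There exists a symmetric fractional hedonic game on 15 agents (with
integer-valued symmetric utilities vanishing on the diagonal) that admits no
individually stable partition. -/
theorem sym_fhg_15_no_IS_partition :
    ∃ v : Fin 15 → Fin 15 → ℤ,
      (∀ i, v i i = 0) ∧
      (∀ i j, v i j = v j i) ∧
      ¬ ∃ π : Fin 15 → Finset (Fin 15),
        IndividuallyStable (fhgPref fun i j => (v i j : ℚ)) π := by
  exact ⟨vv, vv_self, vv_symm, fun ⟨π, h⟩ => no_stable π h⟩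
end
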